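/- Let f be a Feigenbaum map in the class U. Then there is a constant C_1 = C_1(f) > 0 such that |M_n| / |I_n| ≥ C_1 for all integers n ≥ 1, where |·| denotes the length of an interval. -/

import Mathlib

open Set MeasureTheory

/-- `Q_t(x) = -|x|^t`. -/
noncomputable def Qmap (t : ℝ) (x : ℝ) : ℝ := -(|x| ^ t)

/-- Nonlinearity `N(h) = h'' / (h')^2`. -/
noncomputable def Nonlin (h : ℝ → ℝ) (x : ℝ) : ℝ :=
  deriv (deriv h) x / (deriv h x) ^ 2

/-- Schwarzian derivative `S(h) = h'''/h' - (3/2)(h''/h')^2`. -/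
noncomputable def Schw (h : ℝ → ℝ) (x : ℝ) : ℝ :=
  deriv (deriv (deriv h)) x / deriv h x - 3 / 2 * (deriv (deriv h) x / deriv h x) ^ 2

/-- A unimodal map of `[-1,1]`: continuous, increasing on `[-1,0]`, decreasing
on `[0,1]`, even, fixing `-1` and sending `1` to `-1`. -/
def Unimodal (f : ℝ → ℝ) : Prop :=
  ContinuousOn f (Icc (-1) 1) ∧
  StrictMonoOn f (Icc (-1) 0) ∧
  StrictAntiOn f (Icc 0 1) ∧
  (∀ x ∈ Icc (-1 : ℝ) 1, f (-x) = f x) ∧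
  f (-1) = -1 ∧ f 1 = -1 ∧
  MapsTo f (Icc (-1) 1) (Icc (-1) 1)

/-- `h` is a `C³` diffeomorphism of `[-1,0]` onto its image (increasing, with
nonvanishing derivative) with nonpositive Schwarzian derivative. -/
def NegSchwDiffeo (h : ℝ → ℝ) : Prop :=
  ContDiffOn ℝ 3 h (Icc (-1) 0) ∧
  (∀ x ∈ Icc (-1 : ℝ) 0, 0 < deriv h x) ∧
  (∀ x ∈ Icc (-1 : ℝ) 0, Schw h x ≤ 0)

/-- The class `𝒰` of unimodal maps of the form `h ∘ Q_t`, `t > 1`, `h` a `C³`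
diffeomorphism with nonpositive Schwarzian derivative. -/
def InU (f : ℝ → ℝ) : Prop :=
  Unimodal f ∧
  ∃ t : ℝ, 1 < t ∧ ∃ h : ℝ → ℝ, NegSchwDiffeo h ∧
    ∀ x ∈ Icc (-1 : ℝ) 1, f x = h (Qmap t x)

/-- The period-doubling renormalization `α ∘ f² ∘ α⁻¹`, where `α` is the linear
map sending the fixed endpoint `q` of the restrictive interval to `-1`,
i.e. `α (x) = -x/q`. -/
noncomputable def Renorm2 (f : ℝ → ℝ) (q : ℝ) : ℝ → ℝ :=
  fun x => -(f^[2] (-q * x)) / q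

/-- `fs` is the sequence of successive period-doubling renormalizations of
`f = fs 0`: for each `k`, `fs k` is unimodal and renormalizable with return
time `2` via the symmetric interval `[-(|qs k|), |qs k|]`, whose endpoint
`qs k` is fixed by `(fs k)²`, and `fs (k+1)` is the rescaled return map. -/
def FeigSeq (f : ℝ → ℝ) (fs : ℕ → ℝ → ℝ) (qs : ℕ → ℝ) : Prop :=
  fs 0 = f ∧ ∀ k : ℕ,
    Unimodal (fs k) ∧
    0 < |qs k| ∧ |qs k| < 1 ∧
    (fs k)^[2] (qs k) = qs k ∧
    MapsTo ((fs k)^[2]) (Icc (-(|qs k|)) (|qs k|)) (Icc (-(|qs k|)) (|qs k|)) ∧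
    fs (k + 1) = Renorm2 (fs k) (qs k)

/-- A Feigenbaum map: every renormalization is defined and renormalizable with
return time `2`. -/
def Feigenbaum (f : ℝ → ℝ) : Prop := ∃ fs qs, FeigSeq f fs qs

/-- The periodic points `p 0 = -1`, `p 1 ∈ (0,1)` the fixed point of `f`, and
for `n ≥ 2`, `p n` the fixed point of `f^(2^(n-1))` lying strictly between
`-p (n-1)` and `0` or between `0` and `-p (n-1)`.  The interval `I n` is the
closed interval bounded by `p n` and `-p n`, of length `2 * |p n|`. -/
def FeigPoints (f : ℝ → ℝ) (p : ℕ → ℝ) : Prop :=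
  p 0 = -1 ∧ p 1 ∈ Ioo (0 : ℝ) 1 ∧ f (p 1) = p 1 ∧
  ∀ n : ℕ, 2 ≤ n →
    f^[2 ^ (n - 1)] (p n) = p n ∧ 0 < |p n| ∧ |p n| < |p (n - 1)|

/-- The intervals of the partition `η₀`: for an index `i = (s, n)` in
`ℤ ∪ {-0}` (encoded as `Bool × ℕ`, with `|i| = i.2`), `Jint p (true, n)` is the
right component `J n` of `I n \ I (n+1)` and `Jint p (false, n)` is the left
component `J (-n)`. -/
noncomputable def Jint (p : ℕ → ℝ) (i : Bool × ℕ) : Set ℝ :=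
  if i.1 = true then Ioc (|p (i.2 + 1)|) (|p i.2|)
  else Ico (-(|p i.2|)) (-(|p (i.2 + 1)|))

/-- A finite sequence of indices is admissible if consecutively the range of
each inverse branch is contained in the domain of the previous one, i.e.
`J (i_l) ⊆ F (J (i_(l-1))) = f^(2^(|i_(l-1)|)) (J (i_(l-1)))`. -/
def Admissible (f : ℝ → ℝ) (p : ℕ → ℝ) : List (Bool × ℕ) → Prop
  | [] => True
  | [_] => True
  | i :: j :: w => Jint p j ⊆ f^[2 ^ i.2] '' Jint p i ∧ Admissible f p (j :: w)

/-- `gbr i` is the inverse branch `(F|J i)⁻¹` of the induced Markov map `F`,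
where `F = f^(2^(|i|))` on `J i`. -/
def InvBranches (f : ℝ → ℝ) (p : ℕ → ℝ) (gbr : Bool × ℕ → ℝ → ℝ) : Prop :=
  ∀ i : Bool × ℕ,
    (∀ x ∈ Jint p i, gbr i (f^[2 ^ i.2] x) = x) ∧
    MapsTo (gbr i) (f^[2 ^ i.2] '' Jint p i) (Jint p i)

/-- The composed inverse branch `g_w = g_(i₀) ∘ g_(i₁) ∘ ⋯ ∘ g_(i_(k-1))`. -/
def gComp (gbr : Bool × ℕ → ℝ → ℝ) : List (Bool × ℕ) → ℝ → ℝ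
  | [] => id
  | i :: w => gbr i ∘ gComp gbr w

/-- The domain `D(g_w)` of the composed inverse branch: the domain
`F (J (i_(k-1)))` of the last branch. -/
noncomputable def DomG (f : ℝ → ℝ) (p : ℕ → ℝ) (w : List (Bool × ℕ)) : Set ℝ :=
  match w.getLast? with
  | none => ∅
  | some i => f^[2 ^ i.2] '' Jint p i

/-- The length of a set of reals. -/
noncomputable def len (S : Set ℝ) : ℝ := (volume S).toReal

/-- The induced Markov map has the bounded distortion property. -/
def BoundedDistortion (f : ℝ → ℝ) (p : ℕ → ℝ) (gbr : Bool × ℕ → ℝ → ℝ) : Prop :=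
  ∃ C > 0,
    (∀ n : ℕ, ∀ s : Bool,
      C ≤ len (Jint p (s, n)) / ∑' l : ℕ, len (Jint p (s, n + 1 + l))) ∧
    (∀ w : List (Bool × ℕ), w ≠ [] → Admissible f p w →
      ∀ x ∈ DomG f p w, |Nonlin (gComp gbr w) x| ≤ C / len (DomG f p w))

/-- `H` is quasisymmetric on `[-1,1]`. -/
def QuasiSymmetric (H : ℝ → ℝ) : Prop :=
  ∃ M > 0, ∀ x ∈ Icc (-1 : ℝ) 1, ∀ y ∈ Icc (-1 : ℝ) 1, x ≠ y →
    M⁻¹ ≤ |H x - H ((x + y) / 2)| / |H ((x + y) / 2) - H y| ∧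
    |H x - H ((x + y) / 2)| / |H ((x + y) / 2) - H y| ≤ M

/-- `H` is a homeomorphism of `[-1,1]` onto itself. -/
def IntervalHomeo (H : ℝ → ℝ) : Prop :=
  ContinuousOn H (Icc (-1) 1) ∧ BijOn H (Icc (-1) 1) (Icc (-1) 1)

/-- The derivative of the Möbius map `s ↦ (s - x) / (u * ℓ s)` with `ℓ` affine, `ℓ x = u`. -/
lemma hasDerivAt_sub_div_affine {u k x s : ℝ} (hu : u ≠ 0) (hs : u + (s - x) * k ≠ 0) :
    HasDerivAt (fun s => (s - x) / (u * (u + (s - x) * k))) (1 / (u + (s - x) * k) ^ 2) s := by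
  have h1 : HasDerivAt (fun s : ℝ => s - x) 1 s := (hasDerivAt_id s).sub_const x
  have h2 : HasDerivAt (fun s : ℝ => u * (u + (s - x) * k)) (u * (1 * k)) s :=
    ((h1.mul_const k).const_add u).const_mul u
  refine (h1.fun_div h2 (mul_ne_zero hu hs)).congr_deriv ?_
  rw [div_eq_div_iff (pow_ne_zero 2 (mul_ne_zero hu hs)) (pow_ne_zero 2 hs)]
  ring

/-- If the derivative to the power `-1/2` is convex, the product of the derivatives at two points
is at most the square of the slope between them. -/
lemma deriv_mul_deriv_le_of_convexOn {h h' : ℝ → ℝ} {D : Set ℝ}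
    (hd : ∀ x ∈ D, HasDerivAt h (h' x) x) (hpos : ∀ x ∈ D, 0 < h' x)
    (hconv : ConvexOn ℝ D (fun x => h' x ^ (-(1 / 2) : ℝ)))
    {x y : ℝ} (hx : x ∈ D) (hy : y ∈ D) (hxy : x < y) :
    h' x * h' y * (y - x) ^ 2 ≤ (h y - h x) ^ 2 := by
  set φ : ℝ → ℝ := fun x => h' x ^ (-(1 / 2) : ℝ) with hφ
  have hφpos : ∀ s ∈ D, 0 < φ s := fun s hs => Real.rpow_pos_of_pos (hpos s hs) _
  have hφsq : ∀ s ∈ D, h' s = 1 / φ s ^ 2 := by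
    intro s hs
    have : φ s ^ 2 = (h' s)⁻¹ := by
      rw [hφ]
      simp only
      rw [← Real.rpow_natCast, ← Real.rpow_mul (hpos s hs).le]
      norm_num
      exact Real.rpow_neg_one _
    rw [this]; simp
  have hsub : Icc x y ⊆ D := hconv.1.ordConnected.out hx hy
  have hyx : 0 < y - x := sub_pos.2 hxy
  set k := (φ y - φ x) / (y - x) with hk
  have hkey : k * (y - x) = φ y - φ x := by rw [hk]; field_simp
  have hℓ : ∀ s ∈ Icc x y, φ s ≤ φ x + (s - x) * k := by
    intro s hs
    have hw1 : 0 ≤ (y - s) / (y - x) := div_nonneg (by linarith [hs.2]) hyx.le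
    have hw2 : 0 ≤ (s - x) / (y - x) := div_nonneg (by linarith [hs.1]) hyx.le
    have h1 := hconv.2 hx hy hw1 hw2 (by field_simp; ring)
    have h2 : ((y - s) / (y - x)) • x + ((s - x) / (y - x)) • y = s := by
      simp only [smul_eq_mul]; field_simp; ring
    rw [h2] at h1
    refine h1.trans_eq ?_
    simp only [smul_eq_mul, hk]; field_simp; ring
  have hℓpos : ∀ s ∈ Icc x y, 0 < φ x + (s - x) * k := fun s hs =>
    (hφpos s (hsub hs)).trans_le (hℓ s hs)
  have hmono : MonotoneOn (fun s => h s - (s - x) / (φ x * (φ x + (s - x) * k))) (Icc x y) := by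
    have hder : ∀ s ∈ Icc x y, HasDerivAt
        (fun s => h s - (s - x) / (φ x * (φ x + (s - x) * k)))
        (h' s - 1 / (φ x + (s - x) * k) ^ 2) s := fun s hs =>
      (hd s (hsub hs)).sub (hasDerivAt_sub_div_affine (hφpos x hx).ne' (hℓpos s hs).ne')
    refine monotoneOn_of_hasDerivWithinAt_nonneg (convex_Icc x y)
      (fun s hs => (hder s hs).continuousAt.continuousWithinAt)
      (fun s hs => (hder s (interior_subset hs)).hasDerivWithinAt) ?_
    intro s hs
    have hs := interior_subset hs
    rw [hφsq s (hsub hs), sub_nonneg]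
    have := hφpos s (hsub hs)
    have := hℓ s hs
    gcongr
  have h1 := hmono (left_mem_Icc.2 hxy.le) (right_mem_Icc.2 hxy.le) hxy.le
  have h2 : φ x + (y - x) * k = φ y := by linarith
  simp only [sub_self, zero_div, sub_zero, h2] at h1
  have hφx := hφpos x hx
  have hφy := hφpos y hy
  calc h' x * h' y * (y - x) ^ 2 = ((y - x) / (φ x * φ y)) ^ 2 := by
        rw [hφsq x hx, hφsq y hy]; field_simp
    _ ≤ (h y - h x) ^ 2 := by
        have : 0 ≤ (y - x) / (φ x * φ y) := by positivity
        gcongr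
        linarith

/-- For a map with nonpositive Schwarzian derivative, the derivative to the power `-1/2`
is convex. -/
lemma NegSchwDiffeo.convexOn {h : ℝ → ℝ} (hh : NegSchwDiffeo h) :
    ConvexOn ℝ (Ioo (-1) 0) (fun x => deriv h x ^ (-(1 / 2) : ℝ)) := by
  obtain ⟨hc, hpos, hS⟩ := hh
  have hC : ContDiffOn ℝ 3 h (Ioo (-1) 0) := hc.mono Ioo_subset_Icc_self
  have h1 : ContDiffOn ℝ 2 (deriv h) (Ioo (-1) 0) := hC.deriv_of_isOpen isOpen_Ioo (by norm_num)
  have h2 : ContDiffOn ℝ 1 (deriv (deriv h)) (Ioo (-1) 0) :=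
    h1.deriv_of_isOpen isOpen_Ioo (by norm_num)
  have d1 : ∀ x ∈ Ioo (-1 : ℝ) 0, HasDerivAt (deriv h) (deriv (deriv h) x) x := fun x hx =>
    ((h1.contDiffAt (isOpen_Ioo.mem_nhds hx)).differentiableAt (by norm_num)).hasDerivAt
  have d2 : ∀ x ∈ Ioo (-1 : ℝ) 0,
      HasDerivAt (deriv (deriv h)) (deriv (deriv (deriv h)) x) x := fun x hx =>
    ((h2.contDiffAt (isOpen_Ioo.mem_nhds hx)).differentiableAt (by norm_num)).hasDerivAt
  have hpos' : ∀ x ∈ Ioo (-1 : ℝ) 0, 0 < deriv h x := fun x hx =>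
    hpos x (Ioo_subset_Icc_self hx)
  have e1 : ∀ x ∈ Ioo (-1 : ℝ) 0, HasDerivAt (fun x => deriv h x ^ (-(1 / 2) : ℝ))
      (deriv (deriv h) x * (-(1 / 2)) * deriv h x ^ (-(1 / 2) - 1 : ℝ)) x := fun x hx =>
    (d1 x hx).rpow_const (Or.inl (hpos' x hx).ne')
  have e2 : ∀ x ∈ Ioo (-1 : ℝ) 0, HasDerivAt
      (fun x => deriv (deriv h) x * (-(1 / 2)) * deriv h x ^ (-(1 / 2) - 1 : ℝ))
      (deriv (deriv (deriv h)) x * (-(1 / 2)) * deriv h x ^ (-(1 / 2) - 1 : ℝ) +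
        deriv (deriv h) x * (-(1 / 2)) *
          (deriv (deriv h) x * (-(1 / 2) - 1) * deriv h x ^ (-(1 / 2) - 1 - 1 : ℝ))) x :=
    fun x hx => ((d2 x hx).mul_const _).mul ((d1 x hx).rpow_const (Or.inl (hpos' x hx).ne'))
  refine convexOn_of_hasDerivWithinAt2_nonneg (convex_Ioo _ _)
    (fun x hx => (e1 x hx).continuousAt.continuousWithinAt)
    (fun x hx => (e1 x (interior_subset hx)).hasDerivWithinAt)
    (fun x hx => (e2 x (interior_subset hx)).hasDerivWithinAt) ?_
  intro x hx
  have hx := interior_subset hx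
  have hp := hpos' x hx
  have hs := hS x (Ioo_subset_Icc_self hx)
  simp only [Real.rpow_sub_one hp.ne']
  have hr : 0 < deriv h x ^ (-(1 / 2) : ℝ) := Real.rpow_pos_of_pos hp _
  have : deriv (deriv (deriv h)) x * (-(1 / 2)) * (deriv h x ^ (-(1 / 2) : ℝ) / deriv h x) +
        deriv (deriv h) x * (-(1 / 2)) * (deriv (deriv h) x * (-(1 / 2) - 1) *
          (deriv h x ^ (-(1 / 2) : ℝ) / deriv h x / deriv h x)) =
      -(1 / 2) * (deriv h x ^ (-(1 / 2) : ℝ)) * Schw h x := by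
    unfold Schw; field_simp; ring
  rw [this]
  nlinarith

lemma mul_sinh_lt_sinh_mul {t s : ℝ} (ht : 1 < t) (hs : 0 < s) :
    t * Real.sinh s < Real.sinh (t * s) := by
  have hder : ∀ r : ℝ, HasDerivAt (fun r => Real.sinh (t * r) - t * Real.sinh r)
      (Real.cosh (t * r) * (t * 1) - t * Real.cosh r) r := fun r =>
    (((hasDerivAt_id r).const_mul t).sinh).sub ((Real.hasDerivAt_sinh r).const_mul t)
  have hm : StrictMonoOn (fun r => Real.sinh (t * r) - t * Real.sinh r) (Ici 0) := by
    refine strictMonoOn_of_hasDerivWithinAt_pos (convex_Ici 0)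
      (fun r _ => (hder r).continuousAt.continuousWithinAt)
      (fun r _ => (hder r).hasDerivWithinAt) ?_
    intro r hr
    rw [interior_Ici] at hr
    have hr : 0 < r := hr
    have : Real.cosh r < Real.cosh (t * r) := by
      rw [Real.cosh_lt_cosh, abs_of_pos hr, abs_of_pos (by positivity)]
      nlinarith
    nlinarith
  have := hm (mem_Ici.2 le_rfl) (mem_Ici.2 hs.le) hs
  simp at this
  linarith

/-- Power maps of exponent `t > 1` strictly expand cross-ratios infinitesimally. -/
lemma rpow_deriv_mul_deriv_lt {t x y : ℝ} (ht : 1 < t) (hx : 0 < x) (hxy : x < y) :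
    (t * x ^ (t - 1)) * (t * y ^ (t - 1)) * (y - x) ^ 2 < (y ^ t - x ^ t) ^ 2 := by
  have hy : 0 < y := hx.trans hxy
  set s := (Real.log y - Real.log x) / 2 with hs
  set m := (Real.log y + Real.log x) / 2 with hm
  have hspos : 0 < s := by have := Real.log_lt_log hx hxy; rw [hs]; linarith
  have key := mul_sinh_lt_sinh_mul ht hspos
  have ex : ∀ r : ℝ, x ^ r = Real.exp (r * m) * Real.exp (-(r * s)) := by
    intro r; rw [Real.rpow_def_of_pos hx, ← Real.exp_add]; congr 1; rw [hm, hs]; ring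
  have ey : ∀ r : ℝ, y ^ r = Real.exp (r * m) * Real.exp (r * s) := by
    intro r; rw [Real.rpow_def_of_pos hy, ← Real.exp_add]; congr 1; rw [hm, hs]; ring
  have dif : ∀ r : ℝ, y ^ r - x ^ r = Real.exp (r * m) * (2 * Real.sinh (r * s)) := by
    intro r; rw [ex, ey, Real.sinh_eq]; ring
  have d1 := dif 1
  rw [Real.rpow_one, Real.rpow_one, one_mul, one_mul] at d1
  have hprod : x ^ (t - 1) * y ^ (t - 1) * Real.exp m ^ 2 = Real.exp (t * m) ^ 2 := by
    rw [ex, ey, ← Real.exp_nat_mul, ← Real.exp_nat_mul, ← Real.exp_add, ← Real.exp_add,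
      ← Real.exp_add, ← Real.exp_add]
    congr 1; push_cast; ring
  have h0 : 0 < t * Real.sinh s := mul_pos (by linarith) (Real.sinh_pos_iff.2 hspos)
  have hE := Real.exp_pos (t * m)
  calc (t * x ^ (t - 1)) * (t * y ^ (t - 1)) * (y - x) ^ 2
      = (x ^ (t - 1) * y ^ (t - 1) * Real.exp m ^ 2) * (2 * (t * Real.sinh s)) ^ 2 := by
        rw [d1]; ring
    _ = (Real.exp (t * m) * (2 * (t * Real.sinh s))) ^ 2 := by rw [hprod]; ring
    _ < (y ^ t - x ^ t) ^ 2 := by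
        rw [dif t]; gcongr

/-- `g` strictly expands the cross-ratio of every quadruple of points of `S`. -/
def ExpandsCrossRatio (g : ℝ → ℝ) (S : Set ℝ) : Prop :=
  ∀ a ∈ S, ∀ b ∈ S, ∀ c ∈ S, ∀ d ∈ S, a < b → b < c → c < d →
    (c - b) * (d - a) * ((g b - g a) * (g d - g c)) <
      (g c - g b) * (g d - g a) * ((b - a) * (d - c))

/-- Integration of the infinitesimal expansion of cross-ratios. -/
lemma expandsCrossRatio_of_deriv {f f' : ℝ → ℝ} {A B : ℝ} (hc : ContinuousOn f (Icc A B))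
    (hm : StrictMonoOn f (Icc A B)) (hd : ∀ x ∈ Ioo A B, HasDerivAt f (f' x) x)
    (hlt : ∀ x ∈ Ioo A B, ∀ y ∈ Ioo A B, x < y →
      f' x * f' y * (y - x) ^ 2 < (f y - f x) ^ 2) :
    ExpandsCrossRatio f (Icc A B) := by
  intro a ha b hb c hc' d hd' hab hbc hcd
  have hK : ∀ x ∈ Ioo a b,
      f' x * (f c - f x)⁻¹ - (c - x)⁻¹ < f' x * (f d - f x)⁻¹ - (d - x)⁻¹ := by
    intro x hx
    have hxI : x ∈ Ioo A B := ⟨ha.1.trans_lt hx.1, hx.2.trans_le hb.2⟩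
    have hpos : ∀ y ∈ Icc c d, 0 < y - x ∧ 0 < f y - f x := by
      intro y hy
      have hxy : x < y := hx.2.trans (hbc.trans_le hy.1)
      exact ⟨sub_pos.2 hxy, sub_pos.2 (hm (Ioo_subset_Icc_self hxI)
        ⟨hc'.1.trans hy.1, hy.2.trans hd'.2⟩ hxy)⟩
    have hcont : ContinuousOn (fun y => f' x * (f y - f x)⁻¹ - (y - x)⁻¹) (Icc c d) := by
      have hfc : ContinuousOn f (Icc c d) := hc.mono (Icc_subset_Icc hc'.1 hd'.2)
      refine (continuousOn_const.mul ((hfc.sub continuousOn_const).inv₀ ?_)).sub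
        ((continuousOn_id.sub continuousOn_const).inv₀ ?_)
      · exact fun y hy => (hpos y hy).2.ne'
      · exact fun y hy => (hpos y hy).1.ne'
    refine strictMonoOn_of_hasDerivWithinAt_pos (convex_Icc c d) hcont
      (f' := fun y => f' x * (-f' y / (f y - f x) ^ 2) - (-1 / (y - x) ^ 2)) ?_ ?_
      (left_mem_Icc.2 hcd.le) (right_mem_Icc.2 hcd.le) hcd
    · intro y hy
      rw [interior_Icc] at hy
      have hp := hpos y (Ioo_subset_Icc_self hy)
      have hyI : y ∈ Ioo A B := ⟨hc'.1.trans_lt hy.1, hy.2.trans_le hd'.2⟩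
      exact (((((hd y hyI).sub_const (f x)).fun_inv hp.2.ne').const_mul (f' x)).sub
        (((hasDerivAt_id y).sub_const x).fun_inv hp.1.ne')).hasDerivWithinAt
    · intro y hy
      rw [interior_Icc] at hy
      have hp := hpos y (Ioo_subset_Icc_self hy)
      have hyI : y ∈ Ioo A B := ⟨hc'.1.trans_lt hy.1, hy.2.trans_le hd'.2⟩
      have hl := hlt x hxI y hyI (sub_pos.1 hp.1)
      have h1 : 0 < (f y - f x) ^ 2 := pow_pos hp.2 2
      have h2 : 0 < (y - x) ^ 2 := pow_pos hp.1 2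
      have : f' x * (-f' y / (f y - f x) ^ 2) - (-1 / (y - x) ^ 2) =
          ((f y - f x) ^ 2 - f' x * f' y * (y - x) ^ 2) / ((f y - f x) ^ 2 * (y - x) ^ 2) := by
        have n1 := hp.1.ne'
        have n2 := hp.2.ne'
        field_simp
        ring
      rw [this]
      exact div_pos (sub_pos.2 hl) (by positivity)
  have hI : ∀ x ∈ Icc a b, x ∈ Icc A B := fun x hx => ⟨ha.1.trans hx.1, hx.2.trans hb.2⟩
  have hpos : ∀ x ∈ Icc a b, 0 < c - x ∧ 0 < d - x ∧ 0 < f c - f x ∧ 0 < f d - f x := by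
    intro x hx
    have hxc : x < c := hx.2.trans_lt hbc
    exact ⟨sub_pos.2 hxc, sub_pos.2 (hxc.trans hcd), sub_pos.2 (hm (hI x hx) hc' hxc),
      sub_pos.2 (hm (hI x hx) hd' (hxc.trans hcd))⟩
  have hF : StrictMonoOn (fun x => Real.log (f c - f x) - Real.log (f d - f x) -
      (Real.log (c - x) - Real.log (d - x))) (Icc a b) := by
    have hfc : ContinuousOn f (Icc a b) := hc.mono (Icc_subset_Icc ha.1 hb.2)
    refine strictMonoOn_of_hasDerivWithinAt_pos (convex_Icc a b)
      (f' := fun x => -f' x / (f c - f x) - -f' x / (f d - f x) -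
        (-1 / (c - x) - -1 / (d - x))) ?_ ?_ ?_
    · exact (((continuousOn_const.sub hfc).log fun x hx => (hpos x hx).2.2.1.ne').sub
        ((continuousOn_const.sub hfc).log fun x hx => (hpos x hx).2.2.2.ne')).sub
        (((continuousOn_const.sub continuousOn_id).log fun x hx => (hpos x hx).1.ne').sub
        ((continuousOn_const.sub continuousOn_id).log fun x hx => (hpos x hx).2.1.ne'))
    · intro x hx
      rw [interior_Icc] at hx
      have hp := hpos x (Ioo_subset_Icc_self hx)
      have hxI : x ∈ Ioo A B := ⟨ha.1.trans_lt hx.1, hx.2.trans_le hb.2⟩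
      have e := hd x hxI
      exact ((((e.const_sub (f c)).log hp.2.2.1.ne').sub
        ((e.const_sub (f d)).log hp.2.2.2.ne')).sub
        ((((hasDerivAt_id x).const_sub c).log hp.1.ne').sub
        (((hasDerivAt_id x).const_sub d).log hp.2.1.ne'))).hasDerivWithinAt
    · intro x hx
      rw [interior_Icc] at hx
      have := hK x hx
      simp only [div_eq_mul_inv]
      linarith
  have hlog := hF (left_mem_Icc.2 hab.le) (right_mem_Icc.2 hab.le) hab
  obtain ⟨a1, a2, a3, a4⟩ := hpos a (left_mem_Icc.2 hab.le)
  obtain ⟨b1, b2, b3, b4⟩ := hpos b (right_mem_Icc.2 hab.le)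
  have hprod : (f c - f a) * (f d - f b) * ((c - b) * (d - a)) <
      (f c - f b) * (f d - f a) * ((c - a) * (d - b)) := by
    rw [← Real.log_lt_log_iff (by positivity) (by positivity)]
    rw [Real.log_mul (by positivity) (by positivity), Real.log_mul (by positivity) (by positivity),
      Real.log_mul (by positivity) (by positivity), Real.log_mul (by positivity) (by positivity),
      Real.log_mul (by positivity) (by positivity), Real.log_mul (by positivity) (by positivity)]
    simp only at hlog
    linarith
  linarith

lemma ExpandsCrossRatio.congr {g k : ℝ → ℝ} {S : Set ℝ} (h : ExpandsCrossRatio g S)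
    (hk : ∀ x ∈ S, k x = g x) : ExpandsCrossRatio k S := by
  intro a ha b hb c hc d hd
  rw [hk a ha, hk b hb, hk c hc, hk d hd]
  exact h a ha b hb c hc d hd

lemma ExpandsCrossRatio.mono {g : ℝ → ℝ} {S T : Set ℝ} (h : ExpandsCrossRatio g T)
    (hST : S ⊆ T) : ExpandsCrossRatio g S := fun a ha b hb c hc d hd =>
  h a (hST ha) b (hST hb) c (hST hc) d (hST hd)

lemma ExpandsCrossRatio.const_mul {g : ℝ → ℝ} {S : Set ℝ} (h : ExpandsCrossRatio g S)
    {r : ℝ} (hr : r ≠ 0) : ExpandsCrossRatio (fun x => r * g x) S := by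
  intro a ha b hb c hc d hd hab hbc hcd
  have hr2 : 0 < r ^ 2 := by positivity
  have := mul_lt_mul_of_pos_left (h a ha b hb c hc d hd hab hbc hcd) hr2
  simp only
  linarith

lemma ExpandsCrossRatio.comp_mul {g : ℝ → ℝ} {S T : Set ℝ} (h : ExpandsCrossRatio g T)
    {s : ℝ} (hs : s ≠ 0) (hST : ∀ x ∈ S, s * x ∈ T) :
    ExpandsCrossRatio (fun x => g (s * x)) S := by
  intro a ha b hb c hc d hd hab hbc hcd
  have hs2 : 0 < s ^ 2 := by positivity
  rcases lt_or_gt_of_ne hs with hneg | hpos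
  · have := h _ (hST d hd) _ (hST c hc) _ (hST b hb) _ (hST a ha)
      (mul_lt_mul_of_neg_left hcd hneg) (mul_lt_mul_of_neg_left hbc hneg)
      (mul_lt_mul_of_neg_left hab hneg)
    refine lt_of_mul_lt_mul_left ?_ hs2.le
    simp only
    linarith
  · have := h _ (hST a ha) _ (hST b hb) _ (hST c hc) _ (hST d hd)
      (mul_lt_mul_of_pos_left hab hpos) (mul_lt_mul_of_pos_left hbc hpos)
      (mul_lt_mul_of_pos_left hcd hpos)
    refine lt_of_mul_lt_mul_left ?_ hs2.le
    simp only
    linarith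

lemma mul_lt_mul_of_cross {p r P R X Y : ℝ} (hp : 0 < p) (hP : 0 < P) (hR : 0 < R)
    (hX : 0 < X) (h1 : p * R < P * r) (h2 : P * X < Y * R) : p * X < Y * r := by
  have hY : 0 < Y := pos_of_mul_pos_left ((mul_pos hP hX).trans h2) hR.le
  have e1 := mul_lt_mul_of_pos_right h1 hY
  have e2 := mul_lt_mul_of_pos_left h2 hp
  refine lt_of_mul_lt_mul_left ?_ hP.le
  linarith

lemma ExpandsCrossRatio.comp {g h : ℝ → ℝ} {S T : Set ℝ} (hT : ExpandsCrossRatio h T)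
    (hhm : StrictMonoOn h T ∨ StrictAntiOn h T) (hS : ExpandsCrossRatio g S)
    (hgm : StrictMonoOn g S ∨ StrictAntiOn g S) (hmaps : MapsTo g S T) :
    ExpandsCrossRatio (fun x => h (g x)) S := by
  have hX : ∀ a ∈ T, ∀ b ∈ T, ∀ c ∈ T, ∀ d ∈ T, a < b → b < c → c < d →
      0 < (h b - h a) * (h d - h c) := by
    intro a ha b hb c hc d hd hab hbc hcd
    rcases hhm with hh | hh
    · exact mul_pos (sub_pos.2 (hh ha hb hab)) (sub_pos.2 (hh hc hd hcd))
    · exact mul_pos_of_neg_of_neg (sub_neg.2 (hh ha hb hab)) (sub_neg.2 (hh hc hd hcd))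
  intro a ha b hb c hc d hd hab hbc hcd
  have h1 := hS a ha b hb c hc d hd hab hbc hcd
  have p1 : 0 < b - a := sub_pos.2 hab
  have p2 : 0 < c - b := sub_pos.2 hbc
  have p3 : 0 < d - c := sub_pos.2 hcd
  have p4 : 0 < d - a := by linarith
  rcases hgm with hg | hg
  · have q1 := hg ha hb hab
    have q2 := hg hb hc hbc
    have q3 := hg hc hd hcd
    have h2 := hT _ (hmaps ha) _ (hmaps hb) _ (hmaps hc) _ (hmaps hd) q1 q2 q3
    have h3 := hX _ (hmaps ha) _ (hmaps hb) _ (hmaps hc) _ (hmaps hd) q1 q2 q3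
    exact mul_lt_mul_of_cross (mul_pos p2 p4)
      (mul_pos (sub_pos.2 q2) (sub_pos.2 (q1.trans (q2.trans q3))))
      (mul_pos (sub_pos.2 q1) (sub_pos.2 q3)) h3 h1 h2
  · have q1 := hg ha hb hab
    have q2 := hg hb hc hbc
    have q3 := hg hc hd hcd
    have h2 := hT _ (hmaps hd) _ (hmaps hc) _ (hmaps hb) _ (hmaps ha) q3 q2 q1
    have h3 := hX _ (hmaps hd) _ (hmaps hc) _ (hmaps hb) _ (hmaps ha) q3 q2 q1
    have := mul_lt_mul_of_cross (r := (b - a) * (d - c)) (mul_pos p2 p4)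
      (mul_pos (sub_pos.2 q2) (sub_pos.2 (q3.trans (q2.trans q1))))
      (mul_pos (sub_pos.2 q3) (sub_pos.2 q1)) h3 (by linarith) h2
    linarith

/-- A map of the class `𝒰` strictly expands cross-ratios on `[0, 1]`. -/
lemma InU.expandsCrossRatio {f : ℝ → ℝ} (hf : InU f) : ExpandsCrossRatio f (Icc 0 1) := by
  obtain ⟨⟨hc, -, hanti, -⟩, t, ht, h, hh, hfh⟩ := hf
  have hdh : ∀ x ∈ Ioo (-1 : ℝ) 0, HasDerivAt h (deriv h x) x := fun x hx =>
    (differentiableAt_of_deriv_ne_zero (hh.2.1 x (Ioo_subset_Icc_self hx)).ne').hasDerivAt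
  have hQ : ∀ x ∈ Ioo (0 : ℝ) 1, -x ^ t ∈ Ioo (-1 : ℝ) 0 := fun x hx =>
    ⟨neg_lt_neg (Real.rpow_lt_one hx.1.le hx.2 (by linarith)),
      neg_neg_of_pos (Real.rpow_pos_of_pos hx.1 _)⟩
  have hfeq : ∀ x ∈ Ioo (0 : ℝ) 1, f x = h (-x ^ t) := fun x hx => by
    rw [hfh x ⟨by linarith [hx.1], hx.2.le⟩, Qmap, abs_of_pos hx.1]
  have hneg : ExpandsCrossRatio (fun x => -f x) (Icc 0 1) := by
    refine expandsCrossRatio_of_deriv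
      (f' := fun x => -(deriv h (-x ^ t) * -(t * x ^ (t - 1)))) (hc.mono ?_).neg
      hanti.neg ?_ ?_
    · exact Icc_subset_Icc_left (by norm_num)
    · intro x hx
      have hx0 : x ≠ 0 := hx.1.ne'
      refine HasDerivAt.neg (HasDerivAt.congr_of_eventuallyEq
        ((hdh _ (hQ x hx)).comp x (Real.hasDerivAt_rpow_const (Or.inl hx0)).neg) ?_)
      filter_upwards [isOpen_Ioo.mem_nhds hx] with y hy using hfeq y hy
    · intro x hx y hy hxy
      have hQxy : -y ^ t < -x ^ t := neg_lt_neg (Real.rpow_lt_rpow hx.1.le hxy (by linarith))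
      have e1 := deriv_mul_deriv_le_of_convexOn hdh
        (fun x hx => hh.2.1 x (Ioo_subset_Icc_self hx)) hh.convexOn (hQ y hy) (hQ x hx) hQxy
      have e2 := mul_lt_mul_of_pos_left (rpow_deriv_mul_deriv_lt ht hx.1 hxy)
        (mul_pos (hh.2.1 _ (Ioo_subset_Icc_self (hQ y hy)))
          (hh.2.1 _ (Ioo_subset_Icc_self (hQ x hx))))
      simp only [hfeq x hx, hfeq y hy]
      linarith
  refine (hneg.const_mul (r := -1) (by norm_num)).congr fun x _ => by ring

namespace Unimodal

variable {g : ℝ → ℝ}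

lemma apply_le (hg : Unimodal g) {x : ℝ} (hx : x ∈ Icc (-1 : ℝ) 1) : g x ≤ g 0 := by
  obtain ⟨-, hm, ha, -⟩ := hg
  rcases le_total x 0 with h | h
  · exact hm.monotoneOn ⟨hx.1, h⟩ ⟨by norm_num, le_rfl⟩ h
  · exact ha.antitoneOn ⟨le_rfl, by norm_num⟩ ⟨h, hx.2⟩ h

lemma neg_mul_eq (hg : Unimodal g) {q x : ℝ} (hq : |q| ≤ 1) (hx : x ∈ Icc (0 : ℝ) 1) :
    g (-q * x) = g (|q| * x) := by
  have hmem : |q| * x ∈ Icc (-1 : ℝ) 1 :=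
    ⟨by nlinarith [abs_nonneg q, hx.1], by nlinarith [abs_nonneg q, hx.1, hx.2]⟩
  rcases abs_cases q with ⟨h, -⟩ | ⟨h, -⟩
  · rw [h] at hmem ⊢
    rw [neg_mul]
    exact hg.2.2.2.1 _ hmem
  · rw [h]

lemma expandsCrossRatio_left (hg : Unimodal g) (hE : ExpandsCrossRatio g (Icc 0 1)) :
    ExpandsCrossRatio g (Icc (-1) 0) := by
  refine (hE.comp_mul (s := -1) (S := Icc (-1) 0) (by norm_num) ?_).congr ?_
  · exact fun x hx => ⟨by linarith [hx.2], by linarith [hx.1]⟩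
  · intro x hx
    rw [neg_one_mul]
    exact (hg.2.2.2.1 x ⟨hx.1, by linarith [hx.2]⟩).symm

end Unimodal

lemma renorm2_apply (g : ℝ → ℝ) (q x : ℝ) : Renorm2 g q x = -(g (g (-q * x))) / q := rfl

section Renormalization

variable {g : ℝ → ℝ} {q : ℝ}

/-- The restrictive interval of a renormalizable map contains no zero of the map in the
interior of its right half. -/
lemma Unimodal.ne_zero_of_renorm (hg : Unimodal g) (hq0 : 0 < |q|) (hq1 : |q| < 1)
    (hR : Unimodal (Renorm2 g q)) {z : ℝ} (hz : z ∈ Ioo 0 |q|) : g z ≠ 0 := by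
  intro hgz
  have hw : z / |q| ∈ Ioo (0 : ℝ) 1 := ⟨div_pos hz.1 hq0, (div_lt_one hq0).2 hz.2⟩
  have hval : Renorm2 g q (z / |q|) = -(g 0) / q := by
    rw [renorm2_apply, hg.neg_mul_eq hq1.le (Ioo_subset_Icc_self hw), mul_div_cancel₀ _ hq0.ne', hgz]
  have hanti := hR.2.2.1
  have h1 := hanti ⟨le_rfl, zero_le_one⟩ (Ioo_subset_Icc_self hw) hw.1
  have h2 := hanti (Ioo_subset_Icc_self hw) ⟨zero_le_one, le_rfl⟩ hw.2
  rw [hval] at h1 h2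
  rw [renorm2_apply] at h1 h2
  have hmem : ∀ x ∈ Icc (0 : ℝ) 1, g (g (-q * x)) ≤ g 0 := fun x hx =>
    hg.apply_le (hg.2.2.2.2.2.2 (by
      rw [mem_Icc, ← abs_le, abs_mul, abs_neg, abs_of_nonneg hx.1]
      nlinarith [hx.1, hx.2]))
  rcases abs_pos.1 hq0 |>.lt_or_gt with h | h
  · rw [div_lt_div_right_of_neg h] at h1
    linarith [hmem 0 (by simp)]
  · rw [div_lt_div_iff_of_pos_right h] at h2
    linarith [hmem 1 (by simp)]

lemma Unimodal.nonneg_of_renorm (hg : Unimodal g) (hq0 : 0 < |q|) (hq1 : |q| < 1)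
    (hR : Unimodal (Renorm2 g q)) (h0 : 0 < g 0) : ∀ x ∈ Icc 0 |q|, 0 ≤ g x := by
  intro x hx
  by_contra! hneg
  have hsub : Icc 0 x ⊆ Icc (-1 : ℝ) 1 := Icc_subset_Icc (by norm_num) (hx.2.trans hq1.le)
  obtain ⟨z, hz, hgz⟩ := intermediate_value_Ioo' hx.1 (hg.1.mono hsub) ⟨hneg, h0⟩
  exact hg.ne_zero_of_renorm hq0 hq1 hR ⟨hz.1, hz.2.trans_le hx.2⟩ hgz

/-- Renormalization preserves the strict expansion of cross-ratios. -/
lemma ExpandsCrossRatio.renorm2 (hg : Unimodal g) (hE : ExpandsCrossRatio g (Icc 0 1))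
    (hq0 : 0 < |q|) (hq1 : |q| < 1) (hR : Unimodal (Renorm2 g q)) :
    ExpandsCrossRatio (Renorm2 g q) (Icc 0 1) := by
  have hsub : Icc 0 |q| ⊆ Icc (0 : ℝ) 1 := Icc_subset_Icc_right hq1.le
  have hmaps : MapsTo g (Icc 0 |q|) (Icc (-1) 1) := fun x hx =>
    hg.2.2.2.2.2.2 ⟨by linarith [hx.1], (hsub hx).2⟩
  have hgg : ExpandsCrossRatio (fun x => g (g x)) (Icc 0 |q|) := by
    rcases le_or_gt (g 0) 0 with h0 | h0
    · exact (hg.expandsCrossRatio_left hE).comp (Or.inl hg.2.1) (hE.mono hsub)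
        (Or.inr (hg.2.2.1.mono hsub)) fun x hx =>
          ⟨(hmaps hx).1, (hg.apply_le ⟨by linarith [hx.1], (hsub hx).2⟩).trans h0⟩
    · exact hE.comp (Or.inr hg.2.2.1) (hE.mono hsub)
        (Or.inr (hg.2.2.1.mono hsub)) fun x hx =>
          ⟨hg.nonneg_of_renorm hq0 hq1 hR h0 x hx, (hmaps hx).2⟩
  have hscale : ∀ x ∈ Icc (0 : ℝ) 1, |q| * x ∈ Icc 0 |q| := fun x hx =>
    ⟨mul_nonneg hq0.le hx.1, mul_le_of_le_one_right hq0.le hx.2⟩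
  have hq : q ≠ 0 := abs_pos.1 hq0
  refine ((hgg.comp_mul hq0.ne' hscale).const_mul (r := -(1 / q)) (by simp [hq])).congr ?_
  intro x hx
  rw [renorm2_apply, hg.neg_mul_eq hq1.le hx]
  ring

/-- A fixed point of the square of a map increasing on a set is a fixed point of the map. -/
lemma StrictMonoOn.eq_of_apply_apply_eq {S : Set ℝ} (hm : StrictMonoOn g S) {x : ℝ} (hx : x ∈ S)
    (hgx : g x ∈ S) (h : g (g x) = x) : g x = x := by
  rcases lt_trichotomy (g x) x with hlt | heq | hgt
  · have := hm hgx hx hlt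
    linarith
  · exact heq
  · have := hm hx hgx hgt
    linarith

/-- Renormalization of a unimodal map with nonpositive critical value. -/
lemma Unimodal.renorm_of_nonpos (hg : Unimodal g) (hq0 : 0 < |q|) (hq1 : |q| < 1)
    (hqq : g (g q) = q) (h0 : g 0 ≤ 0) :
    q ∈ Ioo (-1 : ℝ) 0 ∧ Renorm2 g q 0 ≤ 0 ∧
      ∀ x ∈ Ico (-1 : ℝ) 0, Renorm2 g q x = x → g (-q * x) = -q * x := by
  have hmaps : ∀ x ∈ Icc (-1 : ℝ) 1, g x ∈ Icc (-1 : ℝ) 0 := fun x hx =>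
    ⟨(hg.2.2.2.2.2.2 hx).1, (hg.apply_le hx).trans h0⟩
  have hsub : Icc (-1 : ℝ) 0 ⊆ Icc (-1) 1 := Icc_subset_Icc_right zero_le_one
  have hqm : q ∈ Icc (-1 : ℝ) 1 := abs_le.1 hq1.le
  have hqle : q ≤ 0 := by
    rw [← hqq]
    exact (hmaps _ (hsub (hmaps _ hqm))).2
  have hqneg : q < 0 := lt_of_le_of_ne hqle (abs_pos.1 hq0)
  refine ⟨⟨(abs_lt.1 hq1).1, hqneg⟩, ?_, ?_⟩
  · rw [renorm2_apply, mul_zero]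
    have := (hmaps _ (hsub (hmaps 0 (by simp)))).2
    exact div_nonpos_of_nonneg_of_nonpos (by linarith) hqle
  · intro x hx hfix
    have hq1' := (abs_lt.1 hq1).1
    have hmem : -q * x ∈ Icc (-1 : ℝ) 0 :=
      ⟨by nlinarith [hx.1, hx.2], by nlinarith [hx.1, hx.2]⟩
    refine hg.2.1.eq_of_apply_apply_eq hmem (hmaps _ (hsub hmem)) ?_
    rw [renorm2_apply, div_eq_iff hqneg.ne] at hfix
    linarith

lemma Unimodal.pos_of_renorm (hg : Unimodal g) (hq0 : 0 < |q|) (hq1 : |q| < 1)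
    (hR : Unimodal (Renorm2 g q)) (h0 : 0 < g 0) : 0 < q := by
  rcases abs_pos.1 hq0 |>.lt_or_gt with h | h
  · exfalso
    have habs : |q| = -q := abs_of_neg h
    have hnn := hg.nonneg_of_renorm hq0 hq1 hR h0
    have hmaps := hg.2.2.2.2.2.2
    have h1 := hR.2.2.1 (left_mem_Icc.2 zero_le_one) (right_mem_Icc.2 zero_le_one) zero_lt_one
    rw [renorm2_apply, renorm2_apply, div_lt_div_right_of_neg h, mul_zero, mul_one, ← habs] at h1
    have h2 := hg.2.2.1 (left_mem_Icc.2 zero_le_one) ⟨hq0.le, hq1.le⟩ hq0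
    have h3 := hg.2.2.1 ⟨hnn |q| (right_mem_Icc.2 hq0.le), (hmaps ⟨by linarith, hq1.le⟩).2⟩
      ⟨h0.le, (hmaps (x := 0) (by simp)).2⟩ h2
    linarith
  · exact h

/-- A unimodal map that expands cross-ratios and whose critical value is mapped to the left of
the critical point has no orbit of period two in `(0, 1)`. -/
lemma Unimodal.eq_of_apply_apply_eq (hg : Unimodal g) (hE : ExpandsCrossRatio g (Icc 0 1))
    (h00 : g (g 0) < 0) {x : ℝ} (hx : x ∈ Ioo (0 : ℝ) 1) (hgx : 0 ≤ g x)
    (hxx : g (g x) = x) : g x = x := by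
  have key : ∀ y, 0 < y → ∀ z, y < z → z ≤ 1 → g y = z → g z = y → False := by
    intro y hy z hyz hz hgy hgz
    have hsub : Icc 0 z ⊆ Icc (0 : ℝ) 1 := Icc_subset_Icc_right hz
    have hcont : ContinuousOn (fun s => g s - s) (Icc y z) :=
      (hg.1.mono (Icc_subset_Icc (by linarith) hz)).sub continuousOn_id
    obtain ⟨P, hP, hgP⟩ := intermediate_value_Ioo' hyz.le hcont
      (show (0 : ℝ) ∈ Ioo (g z - z) (g y - y) from ⟨by linarith, by linarith⟩)
    have hgP : g P = P := sub_eq_zero.1 hgP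
    have hmaps : MapsTo g (Icc 0 z) (Icc 0 1) := by
      intro s hs
      refine ⟨?_, (hg.2.2.2.2.2.2 ⟨by linarith [hs.1], (hsub hs).2⟩).2⟩
      have := hg.2.2.1.antitoneOn (hsub hs) ⟨by linarith, hz⟩ hs.2
      linarith
    have hgg : ExpandsCrossRatio (fun s => g (g s)) (Icc 0 z) :=
      hE.comp (Or.inr hg.2.2.1) (hE.mono hsub) (Or.inr (hg.2.2.1.mono hsub)) hmaps
    have hz0 : 0 < z := hy.trans hyz
    have := hgg 0 ⟨le_rfl, hz0.le⟩ y ⟨hy.le, hyz.le⟩ P ⟨(hy.trans hP.1).le, hP.2.le⟩ z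
      ⟨hz0.le, le_rfl⟩ hy hP.1 hP.2
    simp only [hgy, hgz, hgP] at this
    have h1 : (P - y) * (z - P) * (z * (y - g (g 0))) < (P - y) * (z - P) * ((z - g (g 0)) * y) := by
      linarith
    have h2 := lt_of_mul_lt_mul_left h1 (mul_nonneg (by linarith [hP.1]) (by linarith [hP.2]))
    nlinarith
  have hx1 : x ≤ 1 := hx.2.le
  have hgx1 : g x ≤ 1 := (hg.2.2.2.2.2.2 ⟨by linarith [hx.1], hx1⟩).2
  rcases lt_trichotomy (g x) x with hlt | heq | hgt
  · rcases hgx.eq_or_lt with hz | hpos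
    · rw [← hz] at hxx
      rw [hxx, ← hz] at h00
      exact absurd h00 (lt_irrefl _)
    · exact (key _ hpos _ hlt hx1 hxx rfl).elim
  · exact heq
  · exact (key _ hx.1 _ hgt hgx1 rfl hxx).elim

lemma Unimodal.fixedPoint_unique (hg : Unimodal g) {x y : ℝ} (hx : x ∈ Icc (0 : ℝ) 1)
    (hy : y ∈ Icc (0 : ℝ) 1) (hgx : g x = x) (hgy : g y = y) : x = y := by
  rcases lt_trichotomy x y with h | h | h
  · have := hg.2.2.1 hx hy h
    linarith
  · exact h
  · have := hg.2.2.1 hy hx h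
    linarith

end Renormalization

/-- A map expanding cross-ratios strictly has at most three fixed points. -/
lemma ExpandsCrossRatio.not_four_fixedPoints {g : ℝ → ℝ} {S : Set ℝ} (hE : ExpandsCrossRatio g S)
    {a b c d : ℝ} (ha : a ∈ S) (hb : b ∈ S) (hc : c ∈ S) (hd : d ∈ S) (hab : a < b) (hbc : b < c)
    (hcd : c < d) (hga : g a = a) (hgb : g b = b) (hgc : g c = c) (hgd : g d = d) : False := by
  have := hE a ha b hb c hc d hd hab hbc hcd
  rw [hga, hgb, hgc, hgd] at this
  exact lt_irrefl _ this

namespace FeigSeq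

variable {f : ℝ → ℝ} {fs : ℕ → ℝ → ℝ} {qs : ℕ → ℝ}

lemma unimodal (h : FeigSeq f fs qs) (k : ℕ) : Unimodal (fs k) := (h.2 k).1

lemma unimodal_renorm (h : FeigSeq f fs qs) (k : ℕ) : Unimodal (Renorm2 (fs k) (qs k)) := by
  rw [← (h.2 k).2.2.2.2.2]
  exact h.unimodal (k + 1)

lemma expandsCrossRatio (h : FeigSeq f fs qs) (hf : InU f) (k : ℕ) :
    ExpandsCrossRatio (fs k) (Icc 0 1) := by
  induction k with
  | zero => rw [h.1]; exact hf.expandsCrossRatio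
  | succ k ih =>
    rw [(h.2 k).2.2.2.2.2]
    exact ih.renorm2 (h.unimodal k) (h.2 k).2.1 (h.2 k).2.2.1 (h.unimodal_renorm k)

lemma of_nonpos (h : FeigSeq f fs qs) {k : ℕ} (h0 : fs k 0 ≤ 0) :
    qs k ∈ Ioo (-1 : ℝ) 0 ∧ fs (k + 1) 0 ≤ 0 ∧
      ∀ x ∈ Ico (-1 : ℝ) 0, fs (k + 1) x = x → fs k (-qs k * x) = -qs k * x := by
  rw [(h.2 k).2.2.2.2.2]
  exact (h.unimodal k).renorm_of_nonpos (h.2 k).2.1 (h.2 k).2.2.1 (h.2 k).2.2.2.1 h0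

lemma crit_pos (h : FeigSeq f fs qs) (hf : InU f) (k : ℕ) : 0 < fs k 0 := by
  by_contra! h0
  obtain ⟨⟨a1, a2⟩, h1, A⟩ := h.of_nonpos h0
  obtain ⟨⟨b1, b2⟩, h2, B⟩ := h.of_nonpos h1
  obtain ⟨⟨c1, c2⟩, -, C⟩ := h.of_nonpos h2
  have m1 : (-1 : ℝ) ∈ Ico (-1 : ℝ) 0 := by norm_num
  have fix : ∀ j, fs j (-1) = -1 := fun j => (h.unimodal j).2.2.2.2.1
  have step : ∀ q ∈ Ioo (-1 : ℝ) 0, ∀ x ∈ Ico (-1 : ℝ) 0, -q * x ∈ Ioo (-1 : ℝ) 0 := by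
    intro q hq x hx
    constructor <;> nlinarith [hq.1, hq.2, hx.1, hx.2]
  set y := -qs (k + 2) * -1 with hy
  have hyI : y ∈ Ioo (-1 : ℝ) 0 := step _ ⟨c1, c2⟩ _ m1
  have hyF : fs (k + 2) y = y := C _ m1 (fix _)
  set y1 := -qs (k + 1) * -1 with hy1
  have hy1I : y1 ∈ Ioo (-1 : ℝ) 0 := step _ ⟨b1, b2⟩ _ m1
  have hy1F : fs (k + 1) y1 = y1 := B _ m1 (fix _)
  set y2 := -qs (k + 1) * y with hy2
  have hy2I : y2 ∈ Ioo (-1 : ℝ) 0 := step _ ⟨b1, b2⟩ _ (Ioo_subset_Ico_self hyI)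
  have hy2F : fs (k + 1) y2 = y2 := B _ (Ioo_subset_Ico_self hyI) hyF
  have hlt : y1 < y2 := mul_lt_mul_of_pos_left hyI.1 (by linarith)
  have hq : 0 < -qs k := by linarith
  have l1 : -qs k * -1 < -qs k * y1 := mul_lt_mul_of_pos_left hy1I.1 hq
  have l2 : -qs k * y1 < -qs k * y2 := mul_lt_mul_of_pos_left hlt hq
  have n0 := step _ ⟨a1, a2⟩ _ m1
  have n1 := step _ ⟨a1, a2⟩ _ (Ioo_subset_Ico_self hy1I)
  have n2 := step _ ⟨a1, a2⟩ _ (Ioo_subset_Ico_self hy2I)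
  exact ((h.unimodal k).expandsCrossRatio_left (h.expandsCrossRatio hf k)).not_four_fixedPoints
    (Ico_subset_Icc_self m1) (Ioo_subset_Icc_self n0) (Ioo_subset_Icc_self n1)
    (Ioo_subset_Icc_self n2) n0.1 l1 l2 (fix k) (A _ m1 (fix _))
    (A _ (Ioo_subset_Ico_self hy1I) hy1F) (A _ (Ioo_subset_Ico_self hy2I) hy2F)

lemma q_mem (h : FeigSeq f fs qs) (hf : InU f) (k : ℕ) : qs k ∈ Ioo (0 : ℝ) 1 := by
  have hp := (h.unimodal k).pos_of_renorm (h.2 k).2.1 (h.2 k).2.2.1 (h.unimodal_renorm k)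
    (h.crit_pos hf k)
  exact ⟨hp, (le_abs_self _).trans_lt (h.2 k).2.2.1⟩

lemma succ_apply (h : FeigSeq f fs qs) (k : ℕ) (x : ℝ) :
    fs (k + 1) x = -(fs k (fs k (-qs k * x))) / qs k := by
  rw [(h.2 k).2.2.2.2.2, renorm2_apply]

lemma crit_crit_neg (h : FeigSeq f fs qs) (hf : InU f) (k : ℕ) : fs k (fs k 0) < 0 := by
  have h1 := h.crit_pos hf (k + 1)
  rw [h.succ_apply, mul_zero, lt_div_iff₀ (h.q_mem hf k).1] at h1
  linarith

lemma neg_q_le_crit_crit (h : FeigSeq f fs qs) (hf : InU f) (k : ℕ) :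
    -qs k ≤ fs k (fs k 0) := by
  have := ((h.2 k).2.2.2.2.1 (show (0 : ℝ) ∈ Icc (-|qs k|) |qs k| by simp)).1
  rwa [abs_of_pos (h.q_mem hf k).1] at this

lemma apply_q (h : FeigSeq f fs qs) (hf : InU f) (k : ℕ) : fs k (qs k) = qs k := by
  have hq := h.q_mem hf k
  refine (h.unimodal k).eq_of_apply_apply_eq (h.expandsCrossRatio hf k)
    (h.crit_crit_neg hf k) hq ?_ (h.2 k).2.2.2.1
  exact (h.unimodal k).nonneg_of_renorm (h.2 k).2.1 (h.2 k).2.2.1 (h.unimodal_renorm k)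
    (h.crit_pos hf k) _ ⟨hq.1.le, le_abs_self _⟩

lemma eq_q_of_fixedPoint (h : FeigSeq f fs qs) (hf : InU f) {k : ℕ} {x : ℝ}
    (hx : x ∈ Ioo (0 : ℝ) 1) (hfx : fs k x = x) : x = qs k :=
  (h.unimodal k).fixedPoint_unique (Ioo_subset_Icc_self hx)
    (Ioo_subset_Icc_self (h.q_mem hf k)) hfx (h.apply_q hf k)

/-- The renormalizations have no fixed points in `(-1, 0)`. -/
lemma not_fixedPoint_of_neg (h : FeigSeq f fs qs) (hf : InU f) {k : ℕ} {x : ℝ}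
    (hx : x ∈ Ioo (-1 : ℝ) 0) : fs (k + 1) x ≠ x := by
  intro hfx
  have hq := h.q_mem hf k
  have hg := h.unimodal k
  rw [h.succ_apply, div_eq_iff hq.1.ne'] at hfx
  have hy0 : 0 < -qs k * x := by nlinarith [hq.1, hx.2]
  have hyq : -qs k * x < qs k := by nlinarith [hq.1, hx.1]
  have hgy := hg.2.2.1 ⟨hy0.le, (hyq.trans hq.2).le⟩ (Ioo_subset_Icc_self hq) hyq
  rw [h.apply_q hf k] at hgy
  have hfix := hg.eq_of_apply_apply_eq (h.expandsCrossRatio hf k)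
    (h.crit_crit_neg hf k) ⟨hy0, hyq.trans hq.2⟩ (hq.1.trans hgy).le (by linarith)
  linarith

lemma q_lt_crit (h : FeigSeq f fs qs) (hf : InU f) (k : ℕ) : qs k < fs k 0 := by
  have := (h.unimodal k).2.2.1 ⟨le_rfl, zero_le_one⟩ (Ioo_subset_Icc_self (h.q_mem hf k))
    (h.q_mem hf k).1
  rwa [h.apply_q hf k] at this

lemma crit_lt_one (h : FeigSeq f fs qs) (hf : InU f) (k : ℕ) : fs k 0 < 1 := by
  have hg := h.unimodal k
  refine lt_of_le_of_ne (hg.2.2.2.2.2.2 (by simp)).2 fun h1 => ?_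
  have h2 := h.neg_q_le_crit_crit hf k
  rw [h1, hg.2.2.2.2.2.1] at h2
  linarith [(h.q_mem hf k).2]

end FeigSeq

lemma InU.apply_abs_eq {f : ℝ → ℝ} (hf : InU f) {x : ℝ} (hx : |x| ≤ 1) : f |x| = f x := by
  rcases abs_cases x with ⟨e, -⟩ | ⟨e, -⟩
  · rw [e]
  · rw [e, hf.1.2.2.2.1 x (abs_le.1 hx)]

/-- The scaling factor of the `k`-th renormalization. -/
noncomputable def renormScale (qs : ℕ → ℝ) : ℕ → ℝ
  | 0 => 1
  | k + 1 => renormScale qs k * -qs k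

namespace FeigSeq

variable {f : ℝ → ℝ} {fs : ℕ → ℝ → ℝ} {qs : ℕ → ℝ}

lemma scale_ne_zero (h : FeigSeq f fs qs) (k : ℕ) : renormScale qs k ≠ 0 := by
  induction k with
  | zero => exact one_ne_zero
  | succ k ih => exact mul_ne_zero ih (neg_ne_zero.2 (abs_pos.1 (h.2 k).2.1))

lemma abs_scale_succ (h : FeigSeq f fs qs) (hf : InU f) (k : ℕ) :
    |renormScale qs (k + 1)| = |renormScale qs k| * qs k := by
  rw [renormScale, abs_mul, abs_neg, abs_of_pos (h.q_mem hf k).1]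

lemma abs_scale_le_one (h : FeigSeq f fs qs) (hf : InU f) (k : ℕ) : |renormScale qs k| ≤ 1 := by
  induction k with
  | zero => simp [renormScale]
  | succ k ih =>
    rw [h.abs_scale_succ hf]
    have hq := h.q_mem hf k
    nlinarith [hq.1, hq.2, abs_nonneg (renormScale qs k)]

/-- The iterates of `f` are rescaled renormalizations. -/
lemma iterate_eq (h : FeigSeq f fs qs) (k : ℕ) (x : ℝ) :
    f^[2 ^ k] (renormScale qs k * x) = renormScale qs k * fs k x := by
  induction k generalizing x with
  | zero => simp [renormScale, h.1]
  | succ k ih =>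
    have hq : qs k ≠ 0 := abs_pos.1 (h.2 k).2.1
    rw [pow_succ, mul_two, Function.iterate_add_apply, h.succ_apply, renormScale, mul_assoc, ih, ih]
    field_simp

/-- The periodic points `p (k + 1)` are the endpoints of the restrictive intervals. -/
lemma points_eq (h : FeigSeq f fs qs) (hf : InU f) {p : ℕ → ℝ} (hp : FeigPoints f p) (k : ℕ) :
    p (k + 1) = renormScale qs k * qs k := by
  induction k with
  | zero =>
    rw [renormScale, one_mul]
    refine h.eq_q_of_fixedPoint hf hp.2.1 ?_
    rw [h.1]
    exact hp.2.2.1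
  | succ k ih =>
    obtain ⟨hfix, hpos, hlt⟩ := hp.2.2.2 (k + 2) (by omega)
    have hs := h.scale_ne_zero (k + 1)
    have hs' : 0 < |renormScale qs (k + 1)| := abs_pos.2 hs
    obtain ⟨y, hy⟩ : ∃ y, p (k + 2) = renormScale qs (k + 1) * y :=
      ⟨p (k + 2) / renormScale qs (k + 1), by field_simp⟩
    simp only [show k + 2 - 1 = k + 1 from rfl] at hfix hlt
    rw [hy, h.iterate_eq] at hfix
    have hfy : fs (k + 1) y = y := mul_left_cancel₀ hs hfix
    rw [hy, abs_mul] at hlt hpos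
    rw [ih, abs_mul, abs_of_pos (h.q_mem hf k).1, ← h.abs_scale_succ hf] at hlt
    have hy1 : |y| < 1 := by
      by_contra! hge
      nlinarith
    have hy0 : y ≠ 0 := abs_pos.1 (pos_of_mul_pos_right hpos hs'.le)
    rw [show k + 1 + 1 = k + 2 from rfl, hy]
    rcases hy0.lt_or_gt with hn | hp
    · exact (h.not_fixedPoint_of_neg hf ⟨(abs_lt.1 hy1).1, hn⟩ hfy).elim
    · rw [h.eq_q_of_fixedPoint hf ⟨hp, (abs_lt.1 hy1).2⟩ hfy]

lemma apply_scale_le (h : FeigSeq f fs qs) (hf : InU f) (k : ℕ) {x : ℝ} (hx : |x| ≤ 1) :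
    f (renormScale qs k) ≤ f (renormScale qs k * x) := by
  have hs := h.abs_scale_le_one hf k
  have hle : |renormScale qs k * x| ≤ |renormScale qs k| := by
    rw [abs_mul]
    exact mul_le_of_le_one_right (abs_nonneg _) hx
  rw [← hf.apply_abs_eq hs, ← hf.apply_abs_eq (hle.trans hs)]
  exact hf.1.2.2.1.antitoneOn ⟨abs_nonneg _, hle.trans hs⟩ ⟨abs_nonneg _, hs⟩ hle

/-- The branch of `f^(2^(k+1)-1)` near the critical value, rescaled, extends diffeomorphically
beyond the critical value so as to reach `1 / qs k`, and it expands cross-ratios. -/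
lemma exists_extension (h : FeigSeq f fs qs) (hf : InU f) (k : ℕ) :
    ∃ u : ℝ → ℝ, ∃ z : ℝ, (∀ x, u (f x) = f^[2 ^ (k + 1)] x / renormScale qs (k + 1)) ∧
      f 0 < z ∧ u z = 1 / qs k ∧ ContinuousOn u (Icc (f (renormScale qs (k + 1))) z) ∧
      StrictMonoOn u (Icc (f (renormScale qs (k + 1))) z) ∧
      ExpandsCrossRatio u (Icc (f (renormScale qs (k + 1))) z) := by
  induction k with
  | zero =>
    have hq := h.q_mem hf 0
    have hfq : f (renormScale qs 1) = qs 0 := by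
      have h1 := h.apply_q hf 0
      rw [h.1] at h1
      rw [renormScale, renormScale, one_mul, hf.1.2.2.2.1 _ ⟨by linarith [hq.1], hq.2.le⟩, h1]
    have hsub : Icc (qs 0) 1 ⊆ Icc (0 : ℝ) 1 := Icc_subset_Icc_left hq.1.le
    have hs : (renormScale qs 1)⁻¹ < 0 := by
      rw [inv_lt_zero, renormScale, renormScale]
      linarith [hq.1]
    refine ⟨fun x => (renormScale qs 1)⁻¹ * f x, 1, ?_, ?_, ?_, ?_, ?_, ?_⟩
    · intro x
      simp only [zero_add, pow_one, Function.iterate_succ, Function.iterate_zero, id,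
        Function.comp_apply]
      ring
    · have := h.crit_lt_one hf 0
      rwa [h.1] at this
    · simp only [hf.1.2.2.2.2.2.1, renormScale]
      have := hq.1.ne'
      field_simp
    · rw [hfq]
      exact continuousOn_const.mul (hf.1.1.mono (hsub.trans (Icc_subset_Icc_left (by norm_num))))
    · rw [hfq]
      intro x hx y hy hxy
      exact mul_lt_mul_of_neg_left (hf.1.2.2.1 (hsub hx) (hsub hy) hxy) hs
    · rw [hfq]
      exact (hf.expandsCrossRatio.mono hsub).const_mul hs.ne
  | succ k ih =>
    obtain ⟨u, z, hu, hz, huz, hc, hm, hE⟩ := ih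
    have hq := h.q_mem hf (k + 1)
    have hqk := h.q_mem hf k
    have hg := h.unimodal (k + 1)
    have hs := h.scale_ne_zero (k + 1)
    have hval : ∀ x, u (f (renormScale qs (k + 1) * x)) = fs (k + 1) x := by
      intro x
      rw [hu, h.iterate_eq, mul_div_cancel_left₀ _ hs]
    have hval0 : u (f 0) = fs (k + 1) 0 := by
      have := hval 0
      rwa [mul_zero] at this
    set y₀ := f (renormScale qs (k + 1)) with hy₀
    set y₁ := f (renormScale qs (k + 2)) with hy₁
    have hy₁' : y₁ = f (renormScale qs (k + 1) * -qs (k + 1)) := rfl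
    have huy₁ : u y₁ = qs (k + 1) := by
      rw [hy₁', hval, hg.2.2.2.1 _ ⟨by linarith [hq.1], hq.2.le⟩, h.apply_q hf]
    have hy01 : y₀ ≤ y₁ := by
      rw [hy₁']
      exact h.apply_scale_le hf _ (by rw [abs_neg, abs_of_pos hq.1]; exact hq.2.le)
    have hy0c : y₀ ≤ f 0 := by
      have := h.apply_scale_le hf (k + 1) (x := 0) (by simp)
      rwa [mul_zero] at this
    have hone : (1 : ℝ) < 1 / qs k := (one_lt_div hqk.1).2 hqk.2
    obtain ⟨w, hw, huw⟩ := intermediate_value_Icc hz.le (hc.mono (Icc_subset_Icc_left hy0c))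
      (show (1 : ℝ) ∈ Icc (u (f 0)) (u z) by
        rw [hval0, huz]
        exact ⟨(h.crit_lt_one hf _).le, hone.le⟩)
    have hcw : f 0 < w := by
      refine lt_of_le_of_ne hw.1 fun e => ?_
      rw [← e, hval0] at huw
      exact (h.crit_lt_one hf (k + 1)).ne huw
    have hsub : Icc y₁ w ⊆ Icc y₀ z := Icc_subset_Icc hy01 hw.2
    have hmaps : MapsTo u (Icc y₁ w) (Icc 0 1) := by
      intro x hx
      have hyw := hx.1.trans hx.2
      constructor
      · have := hm.monotoneOn (hsub (left_mem_Icc.2 hyw)) (hsub hx) hx.1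
        linarith [hq.1]
      · rw [← huw]
        exact hm.monotoneOn (hsub hx) (hsub (right_mem_Icc.2 hyw)) hx.2
    have hr : -(qs (k + 1))⁻¹ < 0 := neg_neg_of_pos (inv_pos.2 hq.1)
    refine ⟨fun x => -(qs (k + 1))⁻¹ * fs (k + 1) (u x), w, ?_, hcw, ?_, ?_, ?_, ?_⟩
    · intro x
      have e1 : f^[2 ^ (k + 1)] x = renormScale qs (k + 1) * u (f x) := by
        rw [hu]
        field_simp
      have e2 : f^[2 ^ (k + 1 + 1)] x = renormScale qs (k + 1) * fs (k + 1) (u (f x)) := by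
        rw [pow_succ, mul_two, Function.iterate_add_apply, e1, h.iterate_eq]
      have := hq.1.ne'
      rw [e2, show renormScale qs (k + 1 + 1) = renormScale qs (k + 1) * -qs (k + 1) from rfl]
      field_simp
    · simp only [huw, hg.2.2.2.2.2.1]
      ring
    · exact continuousOn_const.mul ((hg.1.mono (Icc_subset_Icc_left (by norm_num))).comp
        (hc.mono hsub) hmaps)
    · intro x hx y hy hxy
      exact mul_lt_mul_of_neg_left
        (hg.2.2.1 (hmaps hx) (hmaps hy) (hm (hsub hx) (hsub hy) hxy)) hr
    · exact (((h.expandsCrossRatio hf (k + 1)).comp (Or.inr hg.2.2.1) (hE.mono hsub)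
        (Or.inl (hm.mono hsub)) hmaps)).const_mul hr.ne

end FeigSeq

/-- Lower and upper bounds for the slopes of a `C¹` diffeomorphism. -/
lemma NegSchwDiffeo.exists_slope_bounds {h : ℝ → ℝ} (hh : NegSchwDiffeo h) :
    ∃ m M : ℝ, 0 < m ∧ 0 < M ∧ ∀ x ∈ Icc (-1 : ℝ) 0, ∀ y ∈ Icc (-1 : ℝ) 0, x ≤ y →
      m * (y - x) ≤ h y - h x ∧ h y - h x ≤ M * (y - x) := by
  have hdiff : ∀ x ∈ Icc (-1 : ℝ) 0, DifferentiableAt ℝ h x := fun x hx =>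
    differentiableAt_of_deriv_ne_zero (hh.2.1 x hx).ne'
  have hud : UniqueDiffOn ℝ (Icc (-1 : ℝ) 0) := uniqueDiffOn_Icc (by norm_num)
  have hcd : ContinuousOn (deriv h) (Icc (-1) 0) :=
    (hh.1.continuousOn_derivWithin hud (by norm_num)).congr fun x hx =>
      ((hdiff x hx).derivWithin (hud x hx)).symm
  have hne : (Icc (-1 : ℝ) 0).Nonempty := ⟨0, by norm_num⟩
  obtain ⟨a, ha, hmin⟩ := isCompact_Icc.exists_isMinOn hne hcd
  obtain ⟨b, hb, hmax⟩ := isCompact_Icc.exists_isMaxOn hne hcd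
  have hD : DifferentiableOn ℝ h (interior (Icc (-1 : ℝ) 0)) := fun x hx =>
    (hdiff x (interior_subset hx)).differentiableWithinAt
  refine ⟨deriv h a, deriv h b, hh.2.1 a ha, hh.2.1 b hb, fun x hx y hy hxy => ⟨?_, ?_⟩⟩
  · exact (convex_Icc _ _).mul_sub_le_image_sub_of_le_deriv hh.1.continuousOn hD
      (fun s hs => hmin (interior_subset hs)) x hx y hy hxy
  · exact (convex_Icc _ _).image_sub_le_mul_sub_of_deriv_le hh.1.continuousOn hD
      (fun s hs => hmax (interior_subset hs)) x hx y hy hxy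

lemma rpow_sub_rpow_le {t a v : ℝ} (ht : 1 < t) (ha : 0 < a) (hav : a ≤ v) (hv : v ≤ 2 * a) :
    v ^ t - a ^ t ≤ t * 2 ^ (t - 1) * a ^ t * ((v - a) / a) := by
  have hd : ∀ x : ℝ, HasDerivAt (fun x : ℝ => x ^ t) (t * x ^ (t - 1)) x := fun x =>
    Real.hasDerivAt_rpow_const (Or.inr ht.le)
  have key := (convex_Icc a (2 * a)).image_sub_le_mul_sub_of_deriv_le
    (f := fun x : ℝ => x ^ t) (C := t * (2 * a) ^ (t - 1))
    (fun x _ => (hd x).continuousAt.continuousWithinAt)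
    (fun x _ => (hd x).differentiableAt.differentiableWithinAt) (fun x hx => by
      rw [interior_Icc] at hx
      rw [(hd x).deriv]
      have h0 : 0 ≤ x := ha.le.trans hx.1.le
      have h1 : x ≤ 2 * a := hx.2.le
      have h2 : 0 ≤ t - 1 := by linarith
      gcongr) a ⟨le_rfl, by linarith⟩ v ⟨hav, hv⟩ hav
  refine key.trans_eq ?_
  rw [Real.mul_rpow zero_le_two ha.le, Real.rpow_sub_one ha.ne']
  field_simp

/-- Near the critical point, the ratio of the images of two adjacent intervals is controlled. -/
lemma InU.exists_image_ratio_bound {f : ℝ → ℝ} (hf : InU f) :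
    ∃ K > 0, ∀ a v : ℝ, 0 < a → a ≤ v → v ≤ 2 * a → v ≤ 1 →
      f a - f v ≤ K * ((v - a) / a) * (f 0 - f a) := by
  obtain ⟨-, t, ht, h, hh, hfh⟩ := hf
  obtain ⟨m, M, hm, hM, hb⟩ := hh.exists_slope_bounds
  have ht0 : 0 < t := by linarith
  refine ⟨M * (t * 2 ^ (t - 1)) / m, by positivity, fun a v ha hav hv2 hv1 => ?_⟩
  have hv : 0 < v := ha.trans_le hav
  have e : ∀ x ∈ Ioc (0 : ℝ) 1, f x = h (-x ^ t) ∧ -x ^ t ∈ Icc (-1 : ℝ) 0 := fun x hx => by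
    rw [hfh x ⟨by linarith [hx.1], hx.2⟩, Qmap, abs_of_pos hx.1]
    exact ⟨rfl, neg_le_neg (Real.rpow_le_one hx.1.le hx.2 ht0.le),
      neg_nonpos.2 (Real.rpow_nonneg hx.1.le _)⟩
  have e0 : f 0 = h 0 := by
    rw [hfh 0 (by simp), Qmap, abs_zero, Real.zero_rpow ht0.ne', neg_zero]
  obtain ⟨ea, ma⟩ := e a ⟨ha, hav.trans hv1⟩
  obtain ⟨ev, mv⟩ := e v ⟨hv, hv1⟩
  have hpow : a ^ t ≤ v ^ t := Real.rpow_le_rpow ha.le hav ht0.le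
  have h1 := (hb _ mv _ ma (neg_le_neg hpow)).2
  have h2 := (hb _ ma 0 (by simp) ma.2).1
  have h3 := rpow_sub_rpow_le ht ha hav hv2
  rw [ea, ev, e0]
  have hr : 0 ≤ (v - a) / a := div_nonneg (by linarith) ha.le
  have h4 : a ^ t ≤ (h 0 - h (-a ^ t)) / m := by
    rw [le_div_iff₀ hm]
    linarith
  calc h (-a ^ t) - h (-v ^ t) ≤ M * (v ^ t - a ^ t) := by linarith
    _ ≤ M * (t * 2 ^ (t - 1) * a ^ t * ((v - a) / a)) := by gcongr
    _ ≤ M * (t * 2 ^ (t - 1) * ((h 0 - h (-a ^ t)) / m) * ((v - a) / a)) := by gcongr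
    _ = _ := by ring

lemma min_one_le_of_mul_lt {q B w ε K e : ℝ} (hq : 0 < q) (hB : 0 < B) (hw : w ≤ 0) (hε : 0 < ε)
    (hε1 : ε ≤ 1) (hK : 0 < K) (h : (q - w) * B < ε * q * (B + ε * q + (q - w)) * (K * ε))
    (he : e * q ≤ B) : min e 1 ≤ 3 * K * ε ^ 2 := by
  have hr : 0 < q - w := by linarith
  obtain ⟨c, hc⟩ : ∃ c, c = K * ε ^ 2 := ⟨_, rfl⟩
  have hc0 : 0 < c := by rw [hc]; positivity
  have hstep : B < c * (B + 2 * q) := by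
    have hle : q * (B + ε * q + (q - w)) ≤ (q - w) * (B + 2 * q) := by
      have h1 : 0 ≤ -w * B := mul_nonneg (by linarith) hB.le
      have h2 : 0 ≤ -w * q := mul_nonneg (by linarith) hq.le
      have h3 : ε * (q * q) ≤ q * q := mul_le_of_le_one_left (mul_pos hq hq).le hε1
      linarith
    have h1 := mul_le_mul_of_nonneg_left hle hc0.le
    have h2 : (q - w) * B < c * (q * (B + ε * q + (q - w))) := by
      rw [hc]
      linarith
    have h3 : (q - w) * B < (q - w) * (c * (B + 2 * q)) := by linarith
    exact lt_of_mul_lt_mul_left h3 hr.le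
  rw [mul_assoc, ← hc]
  rcases le_or_gt q B with hqB | hqB
  · refine (min_le_right _ _).trans ?_
    have h1 := mul_le_mul_of_nonneg_left hqB hc0.le
    have h2 : 1 * B < 3 * c * B := by linarith
    exact (lt_of_mul_lt_mul_right h2 hB.le).le
  · refine (min_le_left _ _).trans ?_
    have h1 := mul_lt_mul_of_pos_left hqB hc0
    have h2 : e * q < 3 * c * q := by linarith
    exact (lt_of_mul_lt_mul_right h2 hq.le).le

/-- The relative lengths `(f_k 0 - q_k) / q_k` cannot decay faster than quadratically. -/
lemma FeigSeq.exists_recursive_bound {f : ℝ → ℝ} {fs : ℕ → ℝ → ℝ} {qs : ℕ → ℝ}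
    (h : FeigSeq f fs qs) (hf : InU f) :
    ∃ K > 0, ∀ k, (fs (k + 1) 0 - qs (k + 1)) / qs (k + 1) ≤ 1 →
      min ((fs k 0 - qs k) / qs k) 1 ≤
        3 * K * ((fs (k + 1) 0 - qs (k + 1)) / qs (k + 1)) ^ 2 := by
  obtain ⟨K, hK, hb⟩ := hf.exists_image_ratio_bound
  refine ⟨K, hK, fun k hε1 => ?_⟩
  obtain ⟨u, z, hu, hz, huz, -, -, hE⟩ := h.exists_extension hf k
  obtain ⟨hq0, hq1⟩ := h.q_mem hf (k + 1)
  have hqk := h.q_mem hf k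
  have hs := h.scale_ne_zero (k + 1)
  have hs0 := abs_pos.2 hs
  have hs1 := h.abs_scale_le_one hf (k + 1)
  have hqv := h.q_lt_crit hf (k + 1)
  have hv1 := h.crit_lt_one hf (k + 1)
  have hw0 := h.crit_crit_neg hf (k + 1)
  have hwq := h.neg_q_le_crit_crit hf (k + 1)
  have hval : ∀ x, u (f (renormScale qs (k + 1) * x)) = fs (k + 1) x := by
    intro x
    rw [hu, h.iterate_eq, mul_div_cancel_left₀ _ hs]
  have hle : ∀ x, |x| ≤ 1 → f (renormScale qs (k + 1)) ≤ f (renormScale qs (k + 1) * x) :=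
    fun x hx => h.apply_scale_le hf (k + 1) hx
  have hval0 := hval 0
  have hle0 := hle 0 (by simp)
  rw [mul_zero] at hval0 hle0
  set q := qs (k + 1)
  set v := fs (k + 1) 0
  set w := fs (k + 1) v
  set s := renormScale qs (k + 1)
  set A := 1 / qs k with hA
  have hA1 : 1 < A := (one_lt_div hqk.1).2 hqk.2
  have hv0 : 0 < v := hq0.trans hqv
  have heq : ∀ x, 0 ≤ x → x ≤ 1 → f (s * x) = f (|s| * x) := by
    intro x hx hx1
    have e : |s * x| = |s| * x := by rw [abs_mul, abs_of_nonneg hx]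
    rw [← e, hf.apply_abs_eq (by rw [e]; nlinarith)]
  have ha0 : 0 < |s| * q := mul_pos hs0 hq0
  have hav : |s| * q < |s| * v := mul_lt_mul_of_pos_left hqv hs0
  have hV1 : |s| * v ≤ 1 := mul_le_one₀ hs1 hv0.le hv1.le
  have h01 : f (s * v) < f (s * q) := by
    rw [heq v hv0.le hv1.le, heq q hq0.le hq1.le]
    exact hf.1.2.2.1 ⟨ha0.le, hav.le.trans hV1⟩ ⟨(ha0.trans hav).le, hV1⟩ hav
  have h12 : f (s * q) < f 0 := by
    rw [heq q hq0.le hq1.le]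
    exact hf.1.2.2.1 ⟨le_rfl, zero_le_one⟩ ⟨ha0.le, hav.le.trans hV1⟩ ha0
  have hsv := hle v (by rw [abs_of_pos hv0]; exact hv1.le)
  have hcr := hE (f (s * v)) ⟨hsv, by linarith⟩ (f (s * q)) ⟨by linarith, by linarith⟩ (f 0)
    ⟨hle0, hz.le⟩ z ⟨by linarith, le_rfl⟩ h01 h12 hz
  rw [hval, hval, hval0, huz, h.apply_q hf (k + 1)] at hcr
  change (f 0 - f (s * q)) * (z - f (s * v)) * ((q - w) * (A - v)) <
    (v - q) * (A - w) * ((f (s * q) - f (s * v)) * (z - f 0)) at hcr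
  have hratio : f (s * q) - f (s * v) ≤ K * ((v - q) / q) * (f 0 - f (s * q)) := by
    have hv2 : v ≤ 2 * q := by
      rw [div_le_one hq0] at hε1
      linarith
    have := hb (|s| * q) (|s| * v) ha0 hav.le (by nlinarith) hV1
    rwa [← mul_sub, mul_div_mul_left _ _ hs0.ne', ← heq v hv0.le hv1.le,
      ← heq q hq0.le hq1.le] at this
  have heB : (fs k 0 - qs k) / qs k * q ≤ A - v := by
    have hck := h.crit_lt_one hf k
    have hqc := h.q_lt_crit hf k
    have e : A - 1 = (1 - qs k) / qs k := by rw [hA, sub_div, div_self hqk.1.ne']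
    have h1 : (fs k 0 - qs k) / qs k ≤ A - 1 := by
      rw [e]
      gcongr
      · exact hqk.1.le
    have h2 : 0 ≤ (fs k 0 - qs k) / qs k := div_nonneg (by linarith) hqk.1.le
    nlinarith
  obtain ⟨ε, hε⟩ : ∃ ε, ε = (v - q) / q := ⟨_, rfl⟩
  obtain ⟨e, he⟩ : ∃ e, e = (fs k 0 - qs k) / qs k := ⟨_, rfl⟩
  rw [← hε] at hratio hε1 ⊢
  rw [← he] at heB ⊢
  have hvq : v - q = ε * q := by rw [hε, div_mul_cancel₀ _ hq0.ne']
  have hεpos : 0 < ε := by rw [hε]; exact div_pos (by linarith) hq0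
  have hB : 0 < A - v := by linarith
  have hc : 0 < f 0 - f (s * q) := by linarith
  have hd : 0 < z - f 0 := by linarith
  have hmain : (q - w) * (A - v) < ε * q * (A - w) * (K * ε) := by
    have h1 : (f 0 - f (s * q)) * (z - f 0) * ((q - w) * (A - v)) ≤
        (f 0 - f (s * q)) * (z - f (s * v)) * ((q - w) * (A - v)) := by
      have : 0 < q - w := by linarith
      gcongr
      linarith
    have h2 : (v - q) * (A - w) * ((f (s * q) - f (s * v)) * (z - f 0)) ≤
        (v - q) * (A - w) * (K * ε * (f 0 - f (s * q)) * (z - f 0)) := by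
      have : 0 < v - q := by linarith
      have : 0 < A - w := by linarith
      gcongr
    rw [hvq] at hcr h2
    have h3 : (f 0 - f (s * q)) * (z - f 0) * ((q - w) * (A - v)) <
        (f 0 - f (s * q)) * (z - f 0) * (ε * q * (A - w) * (K * ε)) := by linarith
    exact lt_of_mul_lt_mul_left h3 (mul_pos hc hd).le
  have e1 : A - w = A - v + ε * q + (q - w) := by linarith
  rw [e1] at hmain
  exact min_one_le_of_mul_lt hq0 hB hw0.le hεpos hε1 hK hmain heB

/-- The relative lengths `(f_k 0 - q_k) / q_k` are bounded away from zero. -/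
lemma FeigSeq.exists_lower_bound {f : ℝ → ℝ} {fs : ℕ → ℝ → ℝ} {qs : ℕ → ℝ}
    (h : FeigSeq f fs qs) (hf : InU f) :
    ∃ κ > 0, ∀ k, κ ≤ (fs k 0 - qs k) / qs k := by
  obtain ⟨K, hK, hrec⟩ := h.exists_recursive_bound hf
  have hpos : ∀ k, 0 < (fs k 0 - qs k) / qs k := fun k =>
    div_pos (sub_pos.2 (h.q_lt_crit hf k)) (h.q_mem hf k).1
  set κ := min (min ((fs 0 0 - qs 0) / qs 0) 1) (1 / (3 * K)) with hκ
  have hκ0 : 0 < κ := lt_min (lt_min (hpos 0) one_pos) (by positivity)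
  have hκ1 : κ ≤ 1 := (min_le_left _ _).trans (min_le_right _ _)
  refine ⟨κ, hκ0, fun k => ?_⟩
  induction k with
  | zero => exact (min_le_left _ _).trans (min_le_left _ _)
  | succ k ih =>
    rcases le_or_gt ((fs (k + 1) 0 - qs (k + 1)) / qs (k + 1)) 1 with h1 | h1
    · have h2 := (le_min ih hκ1).trans (hrec k h1)
      have h3 : κ * (3 * K) ≤ 1 := (le_div_iff₀ (by positivity)).1 (min_le_right _ _)
      by_contra! hlt
      have := pow_lt_pow_left₀ hlt (hpos (k + 1)).le two_ne_zero
      nlinarith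
    · exact hκ1.trans h1.le

/-- **Lemma 1.** There is `C₁ = C₁(f) > 0` with `|M n| / |I n| ≥ C₁` for all
`n ≥ 1`.  Here `I n` has length `2 * |p n|` and `M n`, the interval bounded by
`p n` and the critical value `c (2^(n-1)) = f^(2^(n-1)) 0`, has length
`|f^(2^(n-1)) 0 - p n|`. -/
theorem lemma1_Mn_In_lower_bound (f : ℝ → ℝ) (p : ℕ → ℝ)
    (hfU : InU f) (hf : Feigenbaum f) (hp : FeigPoints f p) :
    ∃ C₁ > 0, ∀ n : ℕ, 1 ≤ n →
      C₁ ≤ |f^[2 ^ (n - 1)] 0 - p n| / (2 * |p n|) := by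
  obtain ⟨fs, qs, h⟩ := hf
  obtain ⟨κ, hκ, hle⟩ := h.exists_lower_bound hfU
  refine ⟨κ / 2, half_pos hκ, fun n hn => ?_⟩
  obtain ⟨m, rfl⟩ := Nat.exists_eq_add_of_le' hn
  have hit := h.iterate_eq m 0
  rw [mul_zero] at hit
  have hs : 0 < |renormScale qs m| := abs_pos.2 (h.scale_ne_zero m)
  have hq := (h.q_mem hfU m).1
  rw [Nat.add_sub_cancel, hit, h.points_eq hfU hp, ← mul_sub, abs_mul, abs_mul, abs_of_pos hq,
    abs_of_pos (sub_pos.2 (h.q_lt_crit hfU m)), mul_left_comm, mul_div_mul_left _ _ hs.ne',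
    mul_comm 2, ← div_div]
  exact div_le_div_of_nonneg_right (hle m) zero_le_two
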